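/- The map ε : φ(V_D) → V_D is a bijection, and ε(B) ∈ ⟨B⟩ for every B ∈ φ(V_D). -/

import Mathlib

open scoped BigOperators

/-- `W D` : functions `Z/(D+1) → F₂`. -/
abbrev Wsp (D : ℕ) : Type := ZMod (D + 1) → ZMod 2

/-- The all-ones function. -/
def allOnes (D : ℕ) : Wsp D := fun _ => 1

/-- `V D = W/span{u}`. -/
abbrev Vsp (D : ℕ) : Type := Wsp D ⧸ Submodule.span (ZMod 2) {allOnes D}

/-- `e i` : image of the standard basis function at `i`. -/
def eV (D : ℕ) (i : ZMod (D + 1)) : Vsp D :=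
  Submodule.Quotient.mk (Pi.single i 1)

/-- `e_I = ∑_{s ∈ I} e_s`. -/
def eSet (D : ℕ) (I : Finset (ZMod (D + 1))) : Vsp D := ∑ s ∈ I, eV D s

/-- A cyclic interval (arc): nonempty proper subset of the form `{i, i+1, …, j}`. -/
def IsInterval (D : ℕ) (I : Finset (ZMod (D + 1))) : Prop :=
  ∃ (i : ZMod (D + 1)) (l : ℕ), 1 ≤ l ∧ l ≤ D ∧
    I = (Finset.range l).image (fun t : ℕ => i + (t : ZMod (D + 1)))

/-- Member of `ℐ¹` : interval of odd cardinality. -/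
def OddInterval (D : ℕ) (I : Finset (ZMod (D + 1))) : Prop :=
  IsInterval D I ∧ Odd I.card

/-- `I ≺ I'` : `I ⊊ I'` and `I' − I` is a disjoint union of two intervals. -/
def Prec (D : ℕ) (I I' : Finset (ZMod (D + 1))) : Prop :=
  I ⊂ I' ∧ ∃ I₁ I₂, IsInterval D I₁ ∧ IsInterval D I₂ ∧ Disjoint I₁ I₂ ∧ I' \ I = I₁ ∪ I₂

/-- `I ♠ I'` : `I ∩ I' = ∅` and `I ∪ I'` is not an interval. -/
def Spade (D : ℕ) (I I' : Finset (ZMod (D + 1))) : Prop :=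
  I ∩ I' = ∅ ∧ ¬ IsInterval D (I ∪ I')

/-- `I^ev`. -/
noncomputable def evSet (D : ℕ) (I : Finset (ZMod (D + 1))) : Finset (ZMod (D + 1)) :=
  @Finset.filter _
    (fun i => ∃ I' I'', OddInterval D I' ∧ OddInterval D I'' ∧ Spade D I' I'' ∧
      I.erase i = I' ∪ I'')
    (Classical.decPred _) I

/-- `B ∈ φ(V_D)` : a finite set of elements of `ℐ¹` satisfying (P0) and (P1). -/
def phi (D : ℕ) (B : Finset (Finset (ZMod (D + 1)))) : Prop :=
  (∀ I ∈ B, OddInterval D I) ∧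
  (∀ I ∈ B, ∀ I' ∈ B, I = I' ∨ Spade D I I' ∨ Prec D I I' ∨ Prec D I' I) ∧
  (∀ I ∈ B, ∃ 𝒥 : Finset (Finset (ZMod (D + 1))), 𝒥 ⊆ B ∧
    (∀ J ∈ 𝒥, Prec D J I) ∧
    (∀ J ∈ 𝒥, ∀ J' ∈ 𝒥, J ≠ J' → Disjoint J J') ∧
    evSet D I ⊆ 𝒥.biUnion id)

/-- `⟨B⟩` : the F₂-span of `{e_I : I ∈ B}`. -/
def spanB (D : ℕ) (B : Finset (Finset (ZMod (D + 1)))) : Submodule (ZMod 2) (Vsp D) :=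
  Submodule.span (ZMod 2) (eSet D '' ↑B)

/-- `g_i(B) = |{I ∈ B : i ∈ I}|`. -/
def gB (D : ℕ) (B : Finset (Finset (ZMod (D + 1)))) (i : ZMod (D + 1)) : ℕ :=
  (B.filter (fun I => i ∈ I)).card

/-- `ε(B) = ∑_i (g_i(B)(g_i(B)+1)/2 mod 2) e_i`. -/
def epsB (D : ℕ) (B : Finset (Finset (ZMod (D + 1)))) : Vsp D :=
  ∑ i : ZMod (D + 1), ((gB D B i * (gB D B i + 1) / 2 : ℕ) : ZMod 2) • eV D i

/-- The partial order `B' ≤ B` on `φ(V_D)`. -/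
def leφ (D : ℕ) (B' B : Finset (Finset (ZMod (D + 1)))) : Prop :=
  ∃ (k : ℕ) (c : ℕ → Finset (Finset (ZMod (D + 1)))),
    c 0 = B' ∧ c k = B ∧ (∀ s ≤ k, phi D (c s)) ∧
    ∀ s < k, epsB D (c s) ∈ spanB D (c (s + 1))

/-- `B' < B`. -/
def ltφ (D : ℕ) (B' B : Finset (Finset (ZMod (D + 1)))) : Prop :=
  leφ D B' B ∧ B' ≠ B

/-- `1_E ∈ ℂ[V_D]`, the indicator function of `E ⊆ V_D`. -/
noncomputable def ind (D : ℕ) (E : Set (Vsp D)) : Vsp D → ℂ := E.indicator 1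

/-- `δ_x ∈ ℂ[V_D]`. -/
noncomputable def delta (D : ℕ) (x : Vsp D) : Vsp D → ℂ := ind D {x}

/-- The symplectic form on `W`. -/
def formW (D : ℕ) (x y : Wsp D) : ZMod 2 :=
  ∑ i : ZMod (D + 1), (x i * y (i + 1) + x (i + 1) * y i)

/-- The induced symplectic form on `V_D` (well defined since the form kills `u`). -/
noncomputable def formV (D : ℕ) (x y : Vsp D) : ZMod 2 :=
  formW D (Quotient.out x) (Quotient.out y)

/-- The Fourier transform `ℂ[V_D] → ℂ[V_D]`. -/
noncomputable def fourierV (D : ℕ) (f : Vsp D → ℂ) : Vsp D → ℂ :=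
  fun y => (2 : ℂ) ^ (-((D / 2 : ℕ) : ℤ)) *
    ∑ᶠ x : Vsp D, (if formV D x y = 0 then (1 : ℂ) else -1) * f x

/-- The target in `V_D` of the basis vector `e'_ℓ` of `V_{D-2}` under `τ_j`. -/
noncomputable def tauTgt (D j : ℕ) (ℓ : ZMod (D - 2 + 1)) : Vsp D :=
  let L : ℕ := if ℓ.val = 0 then D - 1 else ℓ.val
  if ℓ = ((j - 1 : ℕ) : ZMod (D - 2 + 1)) then
    eV D ((j : ZMod (D + 1)) - 1) + eV D (j : ZMod (D + 1)) + eV D ((j : ZMod (D + 1)) + 1)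
  else if L < j - 1 then eV D (L : ZMod (D + 1))
  else eV D ((L + 2 : ℕ) : ZMod (D + 1))

/-- The linear embedding `τ_j : V_{D-2} → V_D` (well defined independently of the chosen
representative since the targets sum to `0`). -/
noncomputable def tauMap (D j : ℕ) (x : Vsp (D - 2)) : Vsp D :=
  ∑ i : ZMod (D - 2 + 1), (Quotient.out x) i • tauTgt D j i

/-- The arc `{a, a + 1, …, a + l - 1}`. -/
def arc (D : ℕ) (a : ZMod (D + 1)) (l : ℕ) : Finset (ZMod (D + 1)) :=
  (Finset.range l).image (fun t : ℕ => a + (t : ZMod (D + 1)))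

/-- `x` and `y` are neighbours on the cycle `Z/(D+1)`. -/
def CycAdj (D : ℕ) (x y : ZMod (D + 1)) : Prop := y = x + 1 ∨ x = y + 1

section Arcs

variable {D : ℕ}

lemma CycAdj.symm {x y : ZMod (D + 1)} (h : CycAdj D x y) : CycAdj D y x := Or.symm h

lemma natCast_inj_of_lt {s t : ℕ} (hs : s < D + 1) (ht : t < D + 1)
    (h : (s : ZMod (D + 1)) = t) : s = t := by
  rw [← ZMod.val_natCast_of_lt hs, ← ZMod.val_natCast_of_lt ht, h]

lemma exists_coord (k x : ZMod (D + 1)) : ∃ t < D + 1, x = k + (t : ℕ) :=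
  ⟨(x - k).val, ZMod.val_lt _, by simp⟩

lemma natCast_period : ((D + 1 : ℕ) : ZMod (D + 1)) = 0 := ZMod.natCast_self _

lemma mem_arc {a x : ZMod (D + 1)} {l : ℕ} : x ∈ arc D a l ↔ ∃ t < l, x = a + (t : ℕ) := by
  simp [arc, eq_comm]

lemma mem_arc_shift {k : ZMod (D + 1)} {s l t : ℕ} (ht : t < D + 1) (hs : s + l ≤ D + 1) :
    k + (t : ZMod (D + 1)) ∈ arc D (k + (s : ZMod (D + 1))) l ↔ s ≤ t ∧ t < s + l := by
  rw [mem_arc]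
  constructor
  · rintro ⟨u, hu, h⟩
    have : t = s + u := by
      apply natCast_inj_of_lt ht (by omega)
      push_cast
      rw [add_assoc] at h
      exact add_left_cancel h
    omega
  · rintro ⟨h1, h2⟩
    refine ⟨t - s, by omega, ?_⟩
    rw [add_assoc, ← Nat.cast_add]
    congr 2
    omega

lemma mem_arc_coord {k : ZMod (D + 1)} {l t : ℕ} (ht : t < D + 1) (hl : l ≤ D + 1) :
    k + (t : ZMod (D + 1)) ∈ arc D k l ↔ t < l := by
  have := mem_arc_shift (k := k) (s := 0) ht (by omega : 0 + l ≤ D + 1)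
  simpa using this

lemma card_arc {a : ZMod (D + 1)} {l : ℕ} (hl : l ≤ D + 1) : (arc D a l).card = l := by
  rw [arc, Finset.card_image_of_injOn, Finset.card_range]
  intro s hs t ht h
  simp only [Finset.coe_range, Set.mem_Iio] at hs ht
  exact natCast_inj_of_lt (by omega) (by omega) (add_left_cancel h)

lemma isInterval_arc {a : ZMod (D + 1)} {l : ℕ} (h1 : 1 ≤ l) (h2 : l ≤ D) :
    IsInterval D (arc D a l) := ⟨a, l, h1, h2, rfl⟩

lemma IsInterval.exists_arc {I : Finset (ZMod (D + 1))} (h : IsInterval D I) :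
    ∃ a l, 1 ≤ l ∧ l ≤ D ∧ I = arc D a l := h

lemma start_mem_arc {a : ZMod (D + 1)} {l : ℕ} (h1 : 1 ≤ l) : a ∈ arc D a l :=
  mem_arc.2 ⟨0, by omega, by simp⟩

lemma end_notMem_arc {a : ZMod (D + 1)} {l : ℕ} (h2 : l ≤ D) :
    a + (l : ZMod (D + 1)) ∉ arc D a l := by
  rw [mem_arc_coord (by omega) (by omega)]
  omega

lemma pred_notMem_arc {a : ZMod (D + 1)} {l : ℕ} (h2 : l ≤ D) :
    a - 1 ∉ arc D a l := by
  have : a - 1 = a + ((D : ℕ) : ZMod (D + 1)) := by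
    have := natCast_period (D := D)
    push_cast at this
    linear_combination -this
  rw [this, mem_arc_coord (by omega) (by omega)]
  omega

lemma eq_end_of_succ_notMem {a x : ZMod (D + 1)} {l : ℕ}
    (hx : x ∈ arc D a l) (hx' : x + 1 ∉ arc D a l) : x + 1 = a + (l : ZMod (D + 1)) := by
  obtain ⟨t, ht, rfl⟩ := mem_arc.1 hx
  by_cases h : t + 1 < l
  · exact absurd (mem_arc.2 ⟨t + 1, h, by push_cast; ring⟩) hx'
  · have : l = t + 1 := by omega
    subst this
    push_cast
    ring

lemma eq_start_of_pred_notMem {a x : ZMod (D + 1)} {l : ℕ}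
    (hx : x + 1 ∈ arc D a l) (hx' : x ∉ arc D a l) : x + 1 = a := by
  obtain ⟨t, ht, h⟩ := mem_arc.1 hx
  rcases t with _ | t
  · simpa using h
  · refine absurd (mem_arc.2 ⟨t, by omega, ?_⟩) hx'
    push_cast at h
    linear_combination h

lemma exists_shift_of_subset {k p : ZMod (D + 1)} {l L : ℕ} (hl : 1 ≤ l) (hL : L ≤ D)
    (h : arc D p l ⊆ arc D k L) : ∃ s : ℕ, p = k + (s : ZMod (D + 1)) ∧ s + l ≤ L := by
  obtain ⟨s, hs, rfl⟩ := mem_arc.1 (h (start_mem_arc hl))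
  refine ⟨s, rfl, ?_⟩
  by_contra hc
  apply end_notMem_arc (a := k) hL
  apply h
  refine mem_arc.2 ⟨L - s, by omega, ?_⟩
  rw [add_assoc, ← Nat.cast_add]
  congr 2
  omega

/-- A nonempty set meeting an interval and stable under steps inside it contains it. -/
lemma IsInterval.subset_of_step {I : Finset (ZMod (D + 1))} (hI : IsInterval D I)
    {S : Finset (ZMod (D + 1))} {y : ZMod (D + 1)} (hy : y ∈ I) (hyS : y ∈ S)
    (hstep : ∀ u v, CycAdj D u v → u ∈ I → v ∈ I → u ∈ S → v ∈ S) : I ⊆ S := by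
  obtain ⟨a, l, h1, h2, rfl⟩ := hI.exists_arc
  obtain ⟨t, ht, rfl⟩ := mem_arc.1 hy
  have mem : ∀ u < l, a + (u : ZMod (D + 1)) ∈ arc D a l := fun u hu => mem_arc.2 ⟨u, hu, rfl⟩
  have adj : ∀ u : ℕ, CycAdj D (a + (u : ZMod (D + 1))) (a + ((u + 1 : ℕ) : ZMod (D + 1))) :=
    fun u => Or.inl (by push_cast; ring)
  have start : ∀ u ≤ t, a + (u : ZMod (D + 1)) ∈ S := by
    intro u hu
    induction hu using Nat.decreasingInduction with
    | self => exact hyS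
    | of_succ u hu ih => exact hstep _ _ (adj u).symm (mem _ (by omega)) (mem _ (by omega)) ih
  intro x hx
  obtain ⟨u, hu, rfl⟩ := mem_arc.1 hx
  clear hx
  induction u with
  | zero => exact start 0 (by omega)
  | succ u ih => exact hstep _ _ (adj u) (mem _ (by omega)) (mem _ hu) (ih (by omega))

lemma OddInterval.exists_arc {I : Finset (ZMod (D + 1))} (h : OddInterval D I) :
    ∃ a l, 1 ≤ l ∧ l ≤ D ∧ Odd l ∧ I = arc D a l := by
  obtain ⟨a, l, h1, h2, rfl⟩ := h.1.exists_arc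
  have := h.2
  rw [card_arc (by omega)] at this
  exact ⟨a, l, h1, h2, this, rfl⟩

lemma oddInterval_arc {a : ZMod (D + 1)} {l : ℕ} (h1 : Odd l) (h2 : l ≤ D) :
    OddInterval D (arc D a l) :=
  ⟨isInterval_arc h1.pos h2, by rwa [card_arc (by omega)]⟩

lemma IsInterval.union_of_adj {I K : Finset (ZMod (D + 1))} (hI : IsInterval D I)
    (hK : IsInterval D K) (hd : Disjoint I K) (hc : I.card + K.card ≤ D)
    {x y : ZMod (D + 1)} (hxy : CycAdj D x y) (hx : x ∈ I) (hy : y ∈ K) :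
    IsInterval D (I ∪ K) := by
  wlog h : y = x + 1 generalizing I K x y
  · rw [Finset.union_comm]
    exact this hK hI hd.symm (by omega) hxy.symm hy hx (hxy.resolve_left h)
  subst h
  obtain ⟨a, l, h1, h2, rfl⟩ := hI.exists_arc
  obtain ⟨b, m, h3, h4, rfl⟩ := hK.exists_arc
  rw [card_arc (by omega), card_arc (by omega)] at hc
  have e1 := eq_end_of_succ_notMem hx (Finset.disjoint_right.1 hd hy)
  have e2 := eq_start_of_pred_notMem hy (Finset.disjoint_left.1 hd hx)
  have hb : b = a + (l : ZMod (D + 1)) := e2.symm.trans e1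
  subst hb
  refine ⟨a, l + m, by omega, by omega, ?_⟩
  change _ = arc D a (l + m)
  ext z
  obtain ⟨t, ht, rfl⟩ := exists_coord a z
  rw [Finset.mem_union, mem_arc_coord ht (by omega), mem_arc_coord ht (by omega),
    mem_arc_shift ht (by omega)]
  omega

lemma OddInterval.card_add_le {I K : Finset (ZMod (D + 1))} (hD : Even D) (hI : OddInterval D I)
    (hK : OddInterval D K) (hd : Disjoint I K) : I.card + K.card ≤ D := by
  have h1 := Finset.card_le_univ (I ∪ K)
  rw [Finset.card_union_of_disjoint hd, ZMod.card] at h1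
  obtain ⟨a, ha⟩ := hI.2
  obtain ⟨b, hb⟩ := hK.2
  obtain ⟨c, hc⟩ := hD
  omega

lemma Spade.not_adj {I K : Finset (ZMod (D + 1))} (hD : Even D) (hI : OddInterval D I)
    (hK : OddInterval D K) (h : Spade D I K) {x y : ZMod (D + 1)} (hxy : CycAdj D x y)
    (hx : x ∈ I) (hy : y ∈ K) : False :=
  have hd : Disjoint I K := Finset.disjoint_iff_inter_eq_empty.2 h.1
  h.2 (hI.1.union_of_adj hK.1 hd (hI.card_add_le hD hK hd) hxy hx hy)

lemma mem_evSet_arc {k : ZMod (D + 1)} {L t : ℕ} (hL : L ≤ D) (hLo : Odd L)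
    (ht : Odd t) (htL : t < L) : k + (t : ZMod (D + 1)) ∈ evSet D (arc D k L) := by
  classical
  obtain ⟨c, hc⟩ := hLo
  obtain ⟨e, he⟩ := ht
  simp only [evSet, Finset.mem_filter]
  have herase : (arc D k L).erase (k + (t : ZMod (D + 1))) =
      arc D k t ∪ arc D (k + ((t + 1 : ℕ) : ZMod (D + 1))) (L - 1 - t) := by
    ext z
    obtain ⟨u, hu, rfl⟩ := exists_coord k z
    rw [Finset.mem_union, Finset.mem_erase, mem_arc_coord hu (by omega),
      mem_arc_coord hu (by omega), mem_arc_shift hu (by omega), Ne, add_right_inj]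
    have : (u : ZMod (D + 1)) = t ↔ u = t :=
      ⟨natCast_inj_of_lt hu (by omega), fun h => by rw [h]⟩
    rw [this]
    omega
  refine ⟨(mem_arc_coord (by omega) (by omega)).2 htL, arc D k t,
    arc D (k + ((t + 1 : ℕ) : ZMod (D + 1))) (L - 1 - t), oddInterval_arc ⟨e, he⟩ (by omega),
    oddInterval_arc ⟨c - e - 1, by omega⟩ (by omega), ⟨?_, ?_⟩, ?_⟩
  · ext z
    obtain ⟨u, hu, rfl⟩ := exists_coord k z
    rw [Finset.mem_inter, mem_arc_coord hu (by omega), mem_arc_shift hu (by omega)]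
    simp only [Finset.notMem_empty, iff_false]
    omega
  · rw [← herase]
    intro hint
    obtain ⟨q, m, h1, h2, hq⟩ := hint.exists_arc
    have hmem : ∀ u < D + 1, (k + (u : ZMod (D + 1)) ∈ arc D q m ↔ u < L ∧ u ≠ t) := by
      intro u hu
      rw [← hq, Finset.mem_erase, mem_arc_coord hu (by omega), Ne, add_right_inj]
      have : (u : ZMod (D + 1)) = t ↔ u = t :=
        ⟨natCast_inj_of_lt hu (by omega), fun h => by rw [h]⟩
      rw [this]
      tauto
    have step : ∀ u : ℕ, k + (u : ZMod (D + 1)) + 1 = k + ((u + 1 : ℕ) : ZMod (D + 1)) := by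
      intro u; push_cast; ring
    have e1 := eq_end_of_succ_notMem (a := q) (l := m) (x := k + ((t - 1 : ℕ) : ZMod (D + 1)))
      ((hmem _ (by omega)).2 ⟨by omega, by omega⟩)
      (by rw [step, hmem _ (by omega)]; omega)
    have e2 := eq_end_of_succ_notMem (a := q) (l := m) (x := k + ((L - 1 : ℕ) : ZMod (D + 1)))
      ((hmem _ (by omega)).2 ⟨by omega, by omega⟩)
      (by rw [step, hmem _ (by omega)]; omega)
    have := natCast_inj_of_lt (by omega) (by omega)
      (add_left_cancel (add_right_cancel (e1.trans e2.symm)))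
    omega
  · convert herase

lemma exists_odd_coord_of_mem_evSet {k x : ZMod (D + 1)} {L : ℕ} (hD : Even D) (hL : L ≤ D)
    (hLo : Odd L) (hx : x ∈ evSet D (arc D k L)) :
    ∃ t < L, Odd t ∧ x = k + (t : ZMod (D + 1)) := by
  classical
  simp only [evSet, Finset.mem_filter] at hx
  obtain ⟨hxI, I', I'', hI', hI'', hsp, her⟩ := hx
  obtain ⟨t, ht, rfl⟩ := mem_arc.1 hxI
  refine ⟨t, ht, ?_, rfl⟩
  have her' : ∀ z, z ∈ I' ∪ I'' ↔ z ≠ k + (t : ZMod (D + 1)) ∧ z ∈ arc D k L := by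
    intro z
    rw [← her, Finset.mem_erase]
  have houter : ∀ y z, CycAdj D y z → y ∈ I' → z ∉ I' → z ∈ arc D k L →
      z = k + (t : ZMod (D + 1)) := by
    intro y z hyz hy hz hzI
    by_contra hne
    rcases Finset.mem_union.1 ((her' z).2 ⟨hne, hzI⟩) with h | h
    · exact hz h
    · exact hsp.not_adj hD hI' hI'' hyz hy h
  have hsub : I' ⊆ arc D k L := fun z hz => ((her' z).1 (Finset.mem_union_left _ hz)).2
  have hxI' : k + (t : ZMod (D + 1)) ∉ I' :=
    fun h => ((her' _).1 (Finset.mem_union_left _ h)).1 rfl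
  obtain ⟨p, m, h1, h2, hmo, rfl⟩ := hI'.exists_arc
  obtain ⟨s, rfl, hs⟩ := exists_shift_of_subset h1 hL hsub
  rw [mem_arc_shift (by omega) (by omega)] at hxI'
  have hlo : 1 ≤ s → s = t + 1 := by
    intro h
    have := houter (k + (s : ZMod (D + 1))) (k + ((s - 1 : ℕ) : ZMod (D + 1)))
      (Or.inr (by rw [Nat.cast_sub h]; push_cast; ring)) (start_mem_arc h1)
      (by rw [mem_arc_shift (by omega) (by omega)]; omega)
      (by rw [mem_arc_coord (by omega) (by omega)]; omega)
    have := natCast_inj_of_lt (by omega) (by omega) (add_left_cancel this)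
    omega
  have hhi : s + m < L → s + m = t := by
    intro h
    have := houter (k + ((s + m - 1 : ℕ) : ZMod (D + 1))) (k + ((s + m : ℕ) : ZMod (D + 1)))
      (Or.inl (by rw [Nat.cast_sub (by omega)]; push_cast; ring))
      (by rw [mem_arc_shift (by omega) (by omega)]; omega)
      (by rw [mem_arc_shift (by omega) (by omega)]; omega)
      (by rw [mem_arc_coord (by omega) (by omega)]; omega)
    exact natCast_inj_of_lt (by omega) (by omega) (add_left_cancel this)
  obtain ⟨c, hc⟩ := hLo
  obtain ⟨e, he⟩ := hmo
  rw [← Nat.not_even_iff_odd]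
  rintro ⟨f, hf⟩
  omega

lemma prec_of_shift {k : ZMod (D + 1)} {s l L : ℕ} (hl : 1 ≤ l) (hL : L ≤ D) (hs : 1 ≤ s)
    (hsl : s + l < L) : Prec D (arc D (k + (s : ZMod (D + 1))) l) (arc D k L) := by
  refine ⟨?_, arc D k s, arc D (k + ((s + l : ℕ) : ZMod (D + 1))) (L - s - l),
    isInterval_arc hs (by omega), isInterval_arc (by omega) (by omega), ?_, ?_⟩
  · rw [Finset.ssubset_iff_of_subset]
    · refine ⟨k, start_mem_arc (by omega), ?_⟩
      have := mem_arc_shift (D := D) (k := k) (s := s) (l := l) (t := 0) (by omega) (by omega)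
      simp only [Nat.cast_zero, add_zero] at this
      rw [this]
      omega
    · intro z
      obtain ⟨u, hu, rfl⟩ := exists_coord k z
      rw [mem_arc_coord hu (by omega), mem_arc_shift hu (by omega)]
      omega
  · rw [Finset.disjoint_left]
    intro z
    obtain ⟨u, hu, rfl⟩ := exists_coord k z
    rw [mem_arc_coord hu (by omega), mem_arc_shift hu (by omega)]
    omega
  · ext z
    obtain ⟨u, hu, rfl⟩ := exists_coord k z
    rw [Finset.mem_sdiff, Finset.mem_union, mem_arc_coord hu (by omega),
      mem_arc_coord hu (by omega), mem_arc_shift hu (by omega), mem_arc_shift hu (by omega)]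
    omega

end Arcs

/-- Depth functions: neighbouring values differ by exactly one, unless both vanish. -/
def IsDepth (D : ℕ) (g : ZMod (D + 1) → ℕ) : Prop :=
  ∀ x y, CycAdj D x y → g y = g x + 1 ∨ g x = g y + 1 ∨ (g x = 0 ∧ g y = 0)

/-- `I` is a connected component of the superlevel set `{d < g}`. -/
def IsComp (D : ℕ) (g : ZMod (D + 1) → ℕ) (d : ℕ) (I : Finset (ZMod (D + 1))) : Prop :=
  IsInterval D I ∧ (∀ x ∈ I, d < g x) ∧ ∀ x y, CycAdj D x y → x ∈ I → y ∉ I → g y ≤ d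

section Components

variable {D : ℕ} {g : ZMod (D + 1) → ℕ} {d d' : ℕ} {I I' : Finset (ZMod (D + 1))}

lemma IsComp.boundary (hg : IsDepth D g) (hI : IsComp D g d I) {x y : ZMod (D + 1)}
    (hxy : CycAdj D x y) (hx : x ∈ I) (hy : y ∉ I) : g x = d + 1 ∧ g y = d := by
  have h1 := hI.2.1 x hx
  have h2 := hI.2.2 x y hxy hx hy
  have := hg x y hxy
  omega

lemma IsInterval.exists_start (hI : IsInterval D I) : ∃ a ∈ I, a - 1 ∉ I := by
  obtain ⟨a, l, h1, h2, rfl⟩ := hI.exists_arc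
  exact ⟨a, start_mem_arc h1, pred_notMem_arc h2⟩

lemma cycAdj_sub_one (a : ZMod (D + 1)) : CycAdj D a (a - 1) := Or.inr (by ring)

lemma IsComp.level_unique (hg : IsDepth D g) (hI : IsComp D g d I) (hI' : IsComp D g d' I) :
    d = d' := by
  obtain ⟨a, ha, ha'⟩ := hI.1.exists_start
  have h1 := hI.boundary hg (cycAdj_sub_one a) ha ha'
  have h2 := hI'.boundary hg (cycAdj_sub_one a) ha ha'
  omega

lemma IsComp.subset (hI : IsComp D g d I) (hI' : IsComp D g d' I') (hd : d ≤ d')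
    {x : ZMod (D + 1)} (hx : x ∈ I) (hx' : x ∈ I') : I' ⊆ I := by
  refine hI'.1.subset_of_step hx' hx fun u v huv _ hv hu => ?_
  by_contra hvI
  have h1 := hI.2.2 u v huv hu hvI
  have h2 := hI'.2.1 v hv
  omega

lemma IsComp.eq (hI : IsComp D g d I) (hI' : IsComp D g d I')
    {x : ZMod (D + 1)} (hx : x ∈ I) (hx' : x ∈ I') : I = I' :=
  (hI'.subset hI le_rfl hx' hx).antisymm (hI.subset hI' le_rfl hx hx')

lemma IsComp.prec (hg : IsDepth D g) (hI : IsComp D g d I) (hI' : IsComp D g d' I') (hd : d < d')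
    {x : ZMod (D + 1)} (hx : x ∈ I) (hx' : x ∈ I') : Prec D I' I := by
  have hsub := hI.subset hI' hd.le hx hx'
  have hnb : ∀ u v, CycAdj D u v → u ∈ I' → v ∉ I' → v ∈ I := by
    intro u v huv hu hv
    by_contra hvI
    have h1 := hI'.boundary hg huv hu hv
    have h2 := hI.2.2 u v huv (hsub hu) hvI
    omega
  obtain ⟨k, L, h1, h2, rfl⟩ := hI.1.exists_arc
  obtain ⟨p, l, h3, h4, rfl⟩ := hI'.1.exists_arc
  obtain ⟨s, rfl, hs⟩ := exists_shift_of_subset h3 h2 hsub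
  apply prec_of_shift h3 h2
  · by_contra h0
    have h0 : s = 0 := by omega
    subst h0
    have := hnb _ _ (cycAdj_sub_one _) (start_mem_arc h3) (pred_notMem_arc h4)
    rw [Nat.cast_zero, add_zero] at this
    exact pred_notMem_arc h2 this
  · have := hnb (k + ((s + l - 1 : ℕ) : ZMod (D + 1))) (k + ((s + l : ℕ) : ZMod (D + 1)))
      (Or.inl (by rw [Nat.cast_sub (by omega)]; push_cast; ring))
      (by rw [mem_arc_shift (by omega) (by omega)]; omega)
      (by rw [mem_arc_shift (by omega) (by omega)]; omega)
    rwa [mem_arc_coord (by omega) (by omega)] at this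

lemma IsComp.spade (hI : IsComp D g d I) (hI' : IsComp D g d' I') (hd : Disjoint I I') :
    Spade D I I' := by
  refine ⟨Finset.disjoint_iff_inter_eq_empty.1 hd, fun hU => ?_⟩
  obtain ⟨a, ha, -⟩ := hI.1.exists_start
  obtain ⟨b, hb, -⟩ := hI'.1.exists_start
  have : I ∪ I' ⊆ I := by
    refine hU.subset_of_step (Finset.mem_union_left _ ha) ha fun u v huv _ hv hu => ?_
    by_contra hvI
    have hvI' := (Finset.mem_union.1 hv).resolve_left hvI
    have h1 := hI.2.2 u v huv hu hvI
    have h2 := hI.2.1 u hu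
    have h3 := hI'.2.2 v u huv.symm hvI' (Finset.disjoint_left.1 hd hu)
    have h4 := hI'.2.1 v hvI'
    omega
  exact Finset.disjoint_right.1 hd hb (this (Finset.mem_union_right _ hb))

lemma IsDepth.parity (hg : IsDepth D g) (a : ZMod (D + 1)) (t : ℕ)
    (hpos : ∀ u ≤ t, 0 < g (a + (u : ZMod (D + 1)))) :
    (g (a + (t : ZMod (D + 1))) + t) % 2 = g a % 2 := by
  induction t with
  | zero => simp
  | succ t ih =>
    have h1 := ih fun u hu => hpos u (by omega)
    have h2 := hg (a + (t : ZMod (D + 1))) (a + ((t + 1 : ℕ) : ZMod (D + 1)))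
      (Or.inl (by push_cast; ring))
    have h3 := hpos (t + 1) le_rfl
    omega

lemma IsDepth.exists_eq_zero (hD : Even D) (hg : IsDepth D g) : ∃ w, g w = 0 := by
  by_contra! h
  have := hg.parity 0 (D + 1) fun u _ => Nat.pos_of_ne_zero (h _)
  rw [natCast_period, add_zero] at this
  obtain ⟨c, hc⟩ := hD
  omega

lemma IsComp.oddInterval (hg : IsDepth D g) (hI : IsComp D g d I) : OddInterval D I := by
  obtain ⟨a, l, h1, h2, rfl⟩ := hI.1.exists_arc
  refine oddInterval_arc ?_ h2
  have h3 := hI.boundary hg (cycAdj_sub_one a) (start_mem_arc h1) (pred_notMem_arc h2)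
  have h4 := hI.boundary hg (x := a + ((l - 1 : ℕ) : ZMod (D + 1))) (y := a + (l : ZMod (D + 1)))
    (Or.inl (by rw [Nat.cast_sub h1]; push_cast; ring)) (mem_arc.2 ⟨l - 1, by omega, rfl⟩)
    (end_notMem_arc h2)
  have h5 := hg.parity a (l - 1) fun u hu =>
    (Nat.zero_le d).trans_lt (hI.2.1 _ (mem_arc.2 ⟨u, by omega, rfl⟩))
  rw [Nat.odd_iff]
  omega

lemma exists_isComp {x w : ZMod (D + 1)} (hx : d < g x) (hw : g w ≤ d) :
    ∃ I, IsComp D g d I ∧ x ∈ I := by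
  classical
  have hs : ∃ s : ℕ, g (x - (s : ZMod (D + 1))) ≤ d := ⟨(x - w).val, by simpa using hw⟩
  have hr : ∃ r : ℕ, g (x + (r : ZMod (D + 1))) ≤ d := ⟨(w - x).val, by simpa using hw⟩
  obtain ⟨s, hs1, hs2⟩ : ∃ s : ℕ, g (x - (s : ZMod (D + 1))) ≤ d ∧
      ∀ u < s, d < g (x - (u : ZMod (D + 1))) :=
    ⟨Nat.find hs, Nat.find_spec hs, fun u hu => not_le.1 (Nat.find_min hs hu)⟩
  obtain ⟨r, hr1, hr2⟩ : ∃ r : ℕ, g (x + (r : ZMod (D + 1))) ≤ d ∧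
      ∀ u < r, d < g (x + (u : ZMod (D + 1))) :=
    ⟨Nat.find hr, Nat.find_spec hr, fun u hu => not_le.1 (Nat.find_min hr hu)⟩
  have hsD : s < D + 1 := by
    by_contra hc
    have := hs2 (x - w).val (by have := ZMod.val_lt (x - w); omega)
    rw [ZMod.natCast_zmod_val, sub_sub_cancel] at this
    omega
  have hs0 : s ≠ 0 := by
    rintro rfl
    simp only [Nat.cast_zero, sub_zero] at hs1
    omega
  have hr0 : r ≠ 0 := by
    rintro rfl
    simp only [Nat.cast_zero, add_zero] at hr1
    omega
  have hsr : s + r ≤ D + 1 := by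
    by_contra hc
    have := hr2 (D + 1 - s) (by omega)
    rw [Nat.cast_sub hsD.le, natCast_period, zero_sub, ← sub_eq_add_neg] at this
    omega
  have hmem : ∀ t < s + r - 1, d < g (x - (s : ZMod (D + 1)) + 1 + (t : ZMod (D + 1))) := by
    intro t ht
    by_cases h : t + 1 ≤ s
    · have := hs2 (s - (t + 1)) (by omega)
      rw [Nat.cast_sub h] at this
      push_cast at this
      convert this using 2
      ring
    · have := hr2 (t + 1 - s) (by omega)
      rw [Nat.cast_sub (by omega)] at this
      push_cast at this
      convert this using 2
      ring
  refine ⟨arc D (x - (s : ZMod (D + 1)) + 1) (s + r - 1),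
    ⟨isInterval_arc (by omega) (by omega), ?_, ?_⟩, ?_⟩
  · intro y hy
    obtain ⟨t, ht, rfl⟩ := mem_arc.1 hy
    exact hmem t ht
  · rintro y z (rfl | rfl) hy hz
    · rw [eq_end_of_succ_notMem hy hz, Nat.cast_sub (by omega)]
      push_cast
      convert hr1 using 2
      ring
    · have := eq_start_of_pred_notMem hy hz
      rw [add_right_cancel this]
      exact hs1
  · refine mem_arc.2 ⟨s - 1, by omega, ?_⟩
    rw [Nat.cast_sub (by omega)]
    push_cast
    ring

end Components

/-- The family of all components of superlevel sets of `g`. -/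
noncomputable def compFamily (D : ℕ) (g : ZMod (D + 1) → ℕ) : Finset (Finset (ZMod (D + 1))) :=
  @Finset.filter _ (fun I => ∃ d, IsComp D g d I) (Classical.decPred _) Finset.univ

section Families

variable {D : ℕ} {g : ZMod (D + 1) → ℕ} {B : Finset (Finset (ZMod (D + 1)))}

lemma mem_compFamily {I : Finset (ZMod (D + 1))} :
    I ∈ compFamily D g ↔ ∃ d, IsComp D g d I := by
  simp [compFamily]

lemma phi_compFamily (hD : Even D) (hg : IsDepth D g) : phi D (compFamily D g) := by
  classical
  refine ⟨?_, ?_, ?_⟩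
  · intro I hI
    obtain ⟨d, hI⟩ := mem_compFamily.1 hI
    exact hI.oddInterval hg
  · intro I hI I' hI'
    obtain ⟨d, hI⟩ := mem_compFamily.1 hI
    obtain ⟨d', hI'⟩ := mem_compFamily.1 hI'
    by_cases hdis : Disjoint I I'
    · exact Or.inr (Or.inl (hI.spade hI' hdis))
    · obtain ⟨x, hx, hx'⟩ := Finset.not_disjoint_iff.1 hdis
      rcases lt_trichotomy d d' with h | rfl | h
      · exact Or.inr (Or.inr (Or.inr (hI.prec hg hI' h hx hx')))
      · exact Or.inl (hI.eq hI' hx hx')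
      · exact Or.inr (Or.inr (Or.inl (hI'.prec hg hI h hx' hx)))
  · intro I hI
    obtain ⟨d, hI⟩ := mem_compFamily.1 hI
    refine ⟨(compFamily D g).filter fun J => IsComp D g (d + 1) J ∧ J ⊆ I,
      Finset.filter_subset _ _, ?_, ?_, ?_⟩
    · intro J hJ
      obtain ⟨-, hJ, hJI⟩ := Finset.mem_filter.1 hJ
      obtain ⟨a, ha, -⟩ := hJ.1.exists_start
      exact hI.prec hg hJ (Nat.lt_succ_self d) (hJI ha) ha
    · intro J hJ J' hJ' hne
      obtain ⟨-, hJ, -⟩ := Finset.mem_filter.1 hJ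
      obtain ⟨-, hJ', -⟩ := Finset.mem_filter.1 hJ'
      rw [Finset.disjoint_left]
      exact fun x hx hx' => hne (hJ.eq hJ' hx hx')
    · intro x hx
      have hxI : x ∈ I := by
        simp only [evSet, Finset.mem_filter] at hx
        exact hx.1
      obtain ⟨a, l, h1, h2, hlo, rfl⟩ := (hI.oddInterval hg).exists_arc
      have hb := hI.boundary hg (cycAdj_sub_one a) (start_mem_arc h1) (pred_notMem_arc h2)
      obtain ⟨t, ht, hto, rfl⟩ := exists_odd_coord_of_mem_evSet hD h2 hlo hx
      have hp := hg.parity a t fun u hu =>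
        (Nat.zero_le d).trans_lt (hI.2.1 _ (mem_arc.2 ⟨u, by omega, rfl⟩))
      have hd := hI.2.1 _ hxI
      rw [Nat.odd_iff] at hto
      obtain ⟨J, hJ, hxJ⟩ := exists_isComp (g := g) (d := d + 1)
        (x := a + (t : ZMod (D + 1))) (w := a - 1) (by omega) (by omega)
      refine Finset.mem_biUnion.2 ⟨J, Finset.mem_filter.2 ⟨mem_compFamily.2 ⟨_, hJ⟩, hJ, ?_⟩, hxJ⟩
      exact hI.subset hJ (Nat.le_succ d) hxI hxJ

lemma gB_compFamily (hD : Even D) (hg : IsDepth D g) : gB D (compFamily D g) = g := by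
  funext i
  obtain ⟨w, hw⟩ := hg.exists_eq_zero hD
  rw [gB]
  conv_rhs => rw [← Finset.card_range (g i)]
  symm
  have hex : ∀ d ∈ Finset.range (g i), ∃ I, IsComp D g d I ∧ i ∈ I := fun d hd =>
    exists_isComp (Finset.mem_range.1 hd) (by omega : g w ≤ d)
  choose f hf using hex
  refine Finset.card_bij f ?_ ?_ ?_
  · intro d hd
    exact Finset.mem_filter.2 ⟨mem_compFamily.2 ⟨d, (hf d hd).1⟩, (hf d hd).2⟩
  · intro d hd d' hd' h
    exact (hf d hd).1.level_unique hg (h ▸ (hf d' hd').1)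
  · intro I hI
    obtain ⟨hI, hi⟩ := Finset.mem_filter.1 hI
    obtain ⟨d, hI⟩ := mem_compFamily.1 hI
    have hd := Finset.mem_range.2 (hI.2.1 i hi)
    exact ⟨d, hd, (hf d hd).1.eq hI (hf d hd).2 hi⟩

lemma phi.comparable (hB : phi D B) {I K : Finset (ZMod (D + 1))} (hI : I ∈ B) (hK : K ∈ B)
    {x : ZMod (D + 1)} (hx : x ∈ I) (hx' : x ∈ K) : I = K ∨ I ⊂ K ∨ K ⊂ I := by
  rcases hB.2.1 I hI K hK with h | h | h | h
  · exact Or.inl h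
  · exact absurd (Finset.mem_inter.2 ⟨hx, hx'⟩) (h.1 ▸ Finset.notMem_empty x)
  · exact Or.inr (Or.inl h.1)
  · exact Or.inr (Or.inr h.1)

lemma phi.ssubset_of_adj (hD : Even D) (hB : phi D B) {I K : Finset (ZMod (D + 1))} (hI : I ∈ B)
    (hK : K ∈ B) {x y : ZMod (D + 1)} (hxy : CycAdj D x y) (hx : x ∈ I) (hy : y ∉ I)
    (hyK : y ∈ K) : I ⊂ K := by
  rcases hB.2.1 I hI K hK with h | h | h | h
  · exact absurd (h ▸ hyK) hy
  · exact (h.not_adj hD (hB.1 I hI) (hB.1 K hK) hxy hx hyK).elim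
  · exact h.1
  · exact absurd (h.1.1 hyK) hy

lemma phi.exists_of_mem_evSet (hB : phi D B) {K : Finset (ZMod (D + 1))} (hK : K ∈ B)
    {x : ZMod (D + 1)} (hx : x ∈ evSet D K) : ∃ J ∈ B, J ⊂ K ∧ x ∈ J := by
  obtain ⟨𝒥, h1, h2, -, h4⟩ := hB.2.2 K hK
  obtain ⟨J, hJ, hxJ⟩ := Finset.mem_biUnion.1 (h4 hx)
  exact ⟨J, h1 hJ, (h2 J hJ).1, hxJ⟩

/-- Nested members of `B` share no endpoint. -/
lemma phi.mem_of_ssubset (hD : Even D) (hB : phi D B) {I K : Finset (ZMod (D + 1))} (hI : I ∈ B)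
    (hK : K ∈ B) (hIK : I ⊂ K) {x y : ZMod (D + 1)} (hxy : CycAdj D x y) (hx : x ∈ I)
    (hy : y ∉ I) : y ∈ K := by
  classical
  obtain ⟨M, hIM, hM⟩ := Finset.exists_le_maximal (B.filter fun J => J ⊂ K)
    (Finset.mem_filter.2 ⟨hI, hIK⟩)
  obtain ⟨hMB, hMK⟩ := Finset.mem_filter.1 hM.prop
  by_cases hyM : y ∈ M
  · exact hMK.1 hyM
  have hxM : x ∈ M := hIM hx
  have hev : ∀ u v, CycAdj D u v → u ∈ M → v ∉ M → v ∉ evSet D K := by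
    intro u v huv hu hv hvK
    obtain ⟨J, hJ, hJK, hvJ⟩ := hB.exists_of_mem_evSet hK hvK
    have hlt := hB.ssubset_of_adj hD hMB hJ huv hu hv hvJ
    exact hM.not_gt (Finset.mem_filter.2 ⟨hJ, hJK⟩) hlt
  obtain ⟨k, L, h1, h2, hLo, rfl⟩ := (hB.1 K hK).exists_arc
  obtain ⟨p, l, h3, h4, hlo, rfl⟩ := (hB.1 M hMB).exists_arc
  obtain ⟨s, rfl, hs⟩ := exists_shift_of_subset h3 h2 hMK.1
  have hleft : 1 ≤ s → ¬ Odd (s - 1) := fun h ho =>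
    hev (k + (s : ZMod (D + 1))) (k + ((s - 1 : ℕ) : ZMod (D + 1)))
      (Or.inr (by rw [Nat.cast_sub h]; push_cast; ring)) (start_mem_arc h3)
      (by rw [mem_arc_shift (by omega) (by omega)]; omega) (mem_evSet_arc h2 hLo ho (by omega))
  have hright : s + l < L → ¬ Odd (s + l) := fun h ho =>
    hev (k + ((s + l - 1 : ℕ) : ZMod (D + 1))) (k + ((s + l : ℕ) : ZMod (D + 1)))
      (Or.inl (by rw [Nat.cast_sub (by omega)]; push_cast; ring))
      (by rw [mem_arc_shift (by omega) (by omega)]; omega)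
      (by rw [mem_arc_shift (by omega) (by omega)]; omega) (mem_evSet_arc h2 hLo ho h)
  have hne : ¬ (s = 0 ∧ l = L) := by
    rintro ⟨rfl, rfl⟩
    rw [Nat.cast_zero, add_zero] at hMK
    exact hMK.ne rfl
  rw [Nat.odd_iff] at hleft hright hLo hlo
  rcases hxy with rfl | rfl
  · rw [eq_end_of_succ_notMem hxM hyM, add_assoc, ← Nat.cast_add,
      mem_arc_coord (by omega) (by omega)]
    omega
  · have := eq_start_of_pred_notMem hxM hyM
    have hy' : y = k + ((s - 1 : ℕ) : ZMod (D + 1)) := by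
      rw [Nat.cast_sub (by omega)]
      push_cast
      linear_combination this
    rw [hy', mem_arc_coord (by omega) (by omega)]
    omega

lemma phi.filter_eq_erase (hD : Even D) (hB : phi D B) {I : Finset (ZMod (D + 1))} (hI : I ∈ B)
    {x y : ZMod (D + 1)} (hxy : CycAdj D x y) (hx : x ∈ I) (hy : y ∉ I) :
    B.filter (fun K => y ∈ K) = (B.filter (fun K => x ∈ K)).erase I := by
  ext K
  rw [Finset.mem_erase, Finset.mem_filter, Finset.mem_filter]
  constructor
  · rintro ⟨hK, hyK⟩
    have h := hB.ssubset_of_adj hD hI hK hxy hx hy hyK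
    exact ⟨h.ne', hK, h.1 hx⟩
  · rintro ⟨hne, hK, hxK⟩
    refine ⟨hK, ?_⟩
    rcases hB.comparable hI hK hx hxK with h | h | h
    · exact absurd h.symm hne
    · exact hB.mem_of_ssubset hD hI hK h hxy hx hy
    · exact absurd (hB.mem_of_ssubset hD hK hI h hxy hxK fun hyK => hy (h.1 hyK)) hy

lemma phi.gB_eq_succ (hD : Even D) (hB : phi D B) {I : Finset (ZMod (D + 1))} (hI : I ∈ B)
    {x y : ZMod (D + 1)} (hxy : CycAdj D x y) (hx : x ∈ I) (hy : y ∉ I) :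
    gB D B x = gB D B y + 1 := by
  rw [gB, gB, hB.filter_eq_erase hD hI hxy hx hy,
    Finset.card_erase_add_one (Finset.mem_filter.2 ⟨hI, hx⟩)]

lemma phi.gB_eq_zero (hB : phi D B) {x : ZMod (D + 1)}
    (h : ∀ I ∈ B, x ∈ I ↔ x + 1 ∈ I) : gB D B x = 0 := by
  classical
  rw [gB, Finset.card_eq_zero]
  by_contra hne
  obtain ⟨I, hI⟩ := Finset.exists_minimal (Finset.nonempty_iff_ne_empty.2 hne)
  obtain ⟨hIB, hxI⟩ := Finset.mem_filter.1 hI.prop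
  have hx1 := (h I hIB).1 hxI
  have hev : x ∉ evSet D I ∧ x + 1 ∉ evSet D I := by
    constructor <;> intro hx <;> obtain ⟨J, hJ, hJI, hxJ⟩ := hB.exists_of_mem_evSet hIB hx
    · exact hI.not_lt (Finset.mem_filter.2 ⟨hJ, hxJ⟩) hJI
    · exact hI.not_lt (Finset.mem_filter.2 ⟨hJ, (h J hJ).2 hxJ⟩) hJI
  obtain ⟨k, L, h1, h2, hLo, rfl⟩ := (hB.1 I hIB).exists_arc
  obtain ⟨t, ht, rfl⟩ := mem_arc.1 hxI
  have e : k + (t : ZMod (D + 1)) + 1 = k + ((t + 1 : ℕ) : ZMod (D + 1)) := by push_cast; ring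
  rw [e] at hx1 hev
  rw [mem_arc_coord (by omega) (by omega)] at hx1
  rcases Nat.even_or_odd t with ho | ho
  · exact hev.2 (mem_evSet_arc h2 hLo ho.add_one hx1)
  · exact hev.1 (mem_evSet_arc h2 hLo ho ht)

lemma phi.isDepth (hD : Even D) (hB : phi D B) : IsDepth D (gB D B) := by
  have key : ∀ x, gB D B (x + 1) = gB D B x + 1 ∨ gB D B x = gB D B (x + 1) + 1 ∨
      (gB D B x = 0 ∧ gB D B (x + 1) = 0) := by
    intro x
    have hadj : CycAdj D x (x + 1) := Or.inl rfl
    by_cases h1 : ∃ I ∈ B, x ∈ I ∧ x + 1 ∉ I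
    · obtain ⟨I, hI, hx, hy⟩ := h1
      exact Or.inr (Or.inl (hB.gB_eq_succ hD hI hadj hx hy))
    by_cases h2 : ∃ I ∈ B, x + 1 ∈ I ∧ x ∉ I
    · obtain ⟨I, hI, hx, hy⟩ := h2
      exact Or.inl (hB.gB_eq_succ hD hI hadj.symm hx hy)
    push Not at h1 h2
    have h : ∀ I ∈ B, x ∈ I ↔ x + 1 ∈ I := fun I hI => ⟨h1 I hI, h2 I hI⟩
    have e : gB D B (x + 1) = gB D B x := by
      rw [gB, gB]
      congr 1
      exact Finset.filter_congr fun I hI => (h I hI).symm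
    exact Or.inr (Or.inr ⟨hB.gB_eq_zero h, e.trans (hB.gB_eq_zero h)⟩)
  rintro x y (rfl | rfl)
  · exact key x
  · have := key y
    tauto

lemma phi.isComp (hD : Even D) (hB : phi D B) {I : Finset (ZMod (D + 1))} (hI : I ∈ B) :
    IsComp D (gB D B) (B.filter fun K => I ⊂ K).card I := by
  refine ⟨(hB.1 I hI).1, ?_, ?_⟩
  · intro x hx
    apply Finset.card_lt_card
    rw [Finset.ssubset_iff_of_subset]
    · exact ⟨I, Finset.mem_filter.2 ⟨hI, hx⟩, fun h => (Finset.mem_filter.1 h).2.ne rfl⟩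
    · intro K hK
      obtain ⟨hK, hIK⟩ := Finset.mem_filter.1 hK
      exact Finset.mem_filter.2 ⟨hK, hIK.1 hx⟩
  · intro x y hxy hx hy
    apply Finset.card_le_card
    intro K hK
    obtain ⟨hK, hyK⟩ := Finset.mem_filter.1 hK
    exact Finset.mem_filter.2 ⟨hK, hB.ssubset_of_adj hD hI hK hxy hx hy hyK⟩

lemma phi.compFamily_gB (hD : Even D) (hB : phi D B) : compFamily D (gB D B) = B := by
  ext I
  rw [mem_compFamily]
  constructor
  · rintro ⟨d, hI⟩
    have hg := hB.isDepth hD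
    obtain ⟨a, ha, ha'⟩ := hI.1.exists_start
    have hadj := cycAdj_sub_one a
    have h1 := hI.boundary hg hadj ha ha'
    obtain ⟨K, hK, haK, haK'⟩ : ∃ K ∈ B, a ∈ K ∧ a - 1 ∉ K := by
      by_contra! hc
      have : gB D B a ≤ gB D B (a - 1) := by
        apply Finset.card_le_card
        intro K hK
        obtain ⟨hK, haK⟩ := Finset.mem_filter.1 hK
        exact Finset.mem_filter.2 ⟨hK, hc K hK haK⟩
      omega
    have hKc := hB.isComp hD hK
    have h2 := hKc.boundary hg hadj haK haK'
    rw [← h2.2, h1.2] at hKc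
    rwa [hI.eq hKc ha haK]
  · exact fun hI => ⟨_, hB.isComp hD hI⟩

/-- In a finite chain of size `n`, the ranks from the top sum to `n (n + 1) / 2`. -/
lemma sum_card_supersets_of_chain {α : Type*} [DecidableEq α] (C : Finset (Finset α))
    (hC : ∀ I ∈ C, ∀ K ∈ C, I ⊆ K ∨ K ⊆ I) :
    ∑ I ∈ C, (C.filter fun K => I ⊆ K).card = C.card * (C.card + 1) / 2 := by
  have h1 : ∑ I ∈ C, (C.filter fun K => I ⊆ K).card = ∑ I ∈ C, (C.filter fun K => K ⊆ I).card := by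
    simp only [Finset.card_filter]
    exact Finset.sum_comm
  have h2 : ∀ I ∈ C, (C.filter fun K => I ⊆ K).card + (C.filter fun K => K ⊆ I).card
      = C.card + 1 := by
    intro I hI
    rw [← Finset.card_union_add_card_inter, ← Finset.filter_or, ← Finset.filter_and]
    congr 1
    · rw [Finset.filter_true_of_mem fun K hK => hC I hI K hK]
    · rw [Finset.card_eq_one]
      refine ⟨I, ?_⟩
      ext K
      simp only [Finset.mem_filter, Finset.mem_singleton]
      constructor
      · rintro ⟨-, h, h'⟩
        exact h'.antisymm h
      · rintro rfl
        exact ⟨hI, subset_rfl, subset_rfl⟩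
  have h3 := Finset.sum_congr (rfl : C = C) h2
  rw [Finset.sum_add_distrib, ← h1, Finset.sum_const, smul_eq_mul] at h3
  omega

lemma phi.epsB_mem_spanB (hB : phi D B) : epsB D B ∈ spanB D B := by
  classical
  have key : epsB D B =
      ∑ I ∈ B, (((B.filter fun K => I ⊆ K).card : ℕ) : ZMod 2) • eSet D I := by
    have hcoef : ∀ i, ((gB D B i * (gB D B i + 1) / 2 : ℕ) : ZMod 2) =
        ∑ I ∈ B, if i ∈ I then (((B.filter fun K => I ⊆ K).card : ℕ) : ZMod 2) else 0 := by
      intro i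
      rw [gB, ← sum_card_supersets_of_chain, ← Finset.sum_filter, Nat.cast_sum]
      · refine Finset.sum_congr rfl fun I hI => ?_
        congr 2
        rw [Finset.filter_filter]
        refine Finset.filter_congr fun K _ => ?_
        exact ⟨fun h => h.2, fun h => ⟨h (Finset.mem_filter.1 hI).2, h⟩⟩
      · intro I hI K hK
        obtain ⟨hI, hi⟩ := Finset.mem_filter.1 hI
        obtain ⟨hK, hi'⟩ := Finset.mem_filter.1 hK
        rcases hB.comparable hI hK hi hi' with h | h | h
        · exact Or.inl h.subset
        · exact Or.inl h.1
        · exact Or.inr h.1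
    rw [epsB]
    simp_rw [hcoef, Finset.sum_smul]
    rw [Finset.sum_comm]
    refine Finset.sum_congr rfl fun I _ => ?_
    rw [eSet, Finset.smul_sum]
    simp only [ite_smul, zero_smul]
    rw [← Finset.sum_filter]
    simp
  rw [key]
  exact Submodule.sum_mem _ fun I hI =>
    Submodule.smul_mem _ _ (Submodule.subset_span ⟨I, hI, rfl⟩)

end Families

/-- The bijection `ℕ → ℤ` given by `0, 1, 2, 3, 4, … ↦ 0, 1, -1, 2, -2, …`. -/
def foldInt (n : ℕ) : ℤ := if n % 2 = 0 then -((n / 2 : ℕ) : ℤ) else ((n + 1) / 2 : ℕ)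

lemma foldInt_injective : Function.Injective foldInt := by
  intro m n h
  unfold foldInt at h
  split_ifs at h <;> omega

lemma foldInt_surjective : Function.Surjective foldInt := by
  intro z
  by_cases h : 0 < z
  · refine ⟨(2 * z - 1).toNat, ?_⟩
    unfold foldInt
    split_ifs <;> omega
  · refine ⟨(-2 * z).toNat, ?_⟩
    unfold foldInt
    split_ifs <;> omega

lemma foldInt_add_foldInt (m n : ℕ) :
    (foldInt m + foldInt n = 0 ∨ foldInt m + foldInt n = 1) ↔
      n = m + 1 ∨ m = n + 1 ∨ (m = 0 ∧ n = 0) := by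
  unfold foldInt
  split_ifs <;> omega

lemma cast_triangular (n : ℕ) : ((n * (n + 1) / 2 : ℕ) : ZMod 2) = (foldInt n : ZMod 2) := by
  have two : (2 : ZMod 2) = 0 := rfl
  obtain ⟨m, rfl | rfl⟩ := Nat.even_or_odd' n
  · have h1 : 2 * m * (2 * m + 1) / 2 = m * (2 * m + 1) := by
      rw [mul_assoc, Nat.mul_div_cancel_left _ two_pos]
    have h2 : foldInt (2 * m) = -(m : ℤ) := by
      unfold foldInt
      split_ifs <;> omega
    rw [h1, h2]
    push_cast
    linear_combination ((m : ZMod 2) ^ 2 + m) * two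
  · have h1 : (2 * m + 1) * (2 * m + 1 + 1) / 2 = (2 * m + 1) * (m + 1) := by
      rw [show (2 * m + 1) * (2 * m + 1 + 1) = 2 * ((2 * m + 1) * (m + 1)) by ring,
        Nat.mul_div_cancel_left _ two_pos]
    have h2 : foldInt (2 * m + 1) = (m : ℤ) + 1 := by
      unfold foldInt
      split_ifs <;> omega
    rw [h1, h2]
    push_cast
    linear_combination ((m : ZMod 2) ^ 2 + m) * two

section Epsilon

variable {D : ℕ}

lemma sum_smul_eV (f : Wsp D) : ∑ i, f i • eV D i = Submodule.Quotient.mk f := by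
  have : f = ∑ i, f i • (Pi.single i 1 : Wsp D) := by
    funext j
    simp [Finset.sum_apply, Pi.single_apply]
  conv_rhs => rw [this]
  rw [← Submodule.mkQ_apply, map_sum]
  simp only [map_smul]
  rfl

lemma epsB_eq_mk (B : Finset (Finset (ZMod (D + 1)))) :
    epsB D B = Submodule.Quotient.mk fun i => (foldInt (gB D B i) : ZMod 2) := by
  rw [← sum_smul_eV, epsB]
  simp only [cast_triangular]

lemma mk_eq_mk_iff (f f' : Wsp D) :
    (Submodule.Quotient.mk f : Vsp D) = Submodule.Quotient.mk f' ↔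
      ∃ c : ZMod 2, ∀ i, f i = f' i + c := by
  rw [Submodule.Quotient.eq, Submodule.mem_span_singleton]
  refine exists_congr fun c => ?_
  rw [funext_iff]
  refine forall_congr' fun i => ?_
  simp only [allOnes, Pi.smul_apply, smul_eq_mul, mul_one, Pi.sub_apply]
  rw [eq_comm, sub_eq_iff_eq_add, add_comm]

/-- An alternating function on a cycle of odd length vanishes. -/
lemma eq_zero_of_alternating (hD : Even D) (δ : ZMod (D + 1) → ℤ) (h : ∀ i, δ i + δ (i + 1) = 0)
    (i : ZMod (D + 1)) : δ i = 0 := by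
  have key : ∀ t : ℕ, δ (i + (t : ZMod (D + 1))) = (-1) ^ t * δ i := by
    intro t
    induction t with
    | zero => simp
    | succ t ih =>
      have := h (i + (t : ZMod (D + 1)))
      rw [Nat.cast_succ, ← add_assoc, pow_succ]
      linear_combination this - ih
  have h1 := key (D + 1)
  rw [natCast_period, add_zero, hD.add_one.neg_one_pow] at h1
  omega

lemma eq_of_mod_two (hD : Even D) {z z' : ZMod (D + 1) → ℤ}
    (hz : ∀ i, z i + z (i + 1) = 0 ∨ z i + z (i + 1) = 1)
    (hz' : ∀ i, z' i + z' (i + 1) = 0 ∨ z' i + z' (i + 1) = 1)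
    {c : ZMod 2} (h : ∀ i, (z i : ZMod 2) = (z' i : ZMod 2) + c) : z = z' := by
  funext i
  rw [← sub_eq_zero]
  refine eq_zero_of_alternating hD (fun i => z i - z' i) (fun i => ?_) i
  have hc : ((z i + z (i + 1) : ℤ) : ZMod 2) = ((z' i + z' (i + 1) : ℤ) : ZMod 2) := by
    push_cast
    have two : (2 : ZMod 2) = 0 := rfl
    rw [h i, h (i + 1)]
    linear_combination c * two
  rw [ZMod.intCast_eq_intCast_iff'] at hc
  have h1 := hz i
  have h2 := hz' i
  push_cast at hc
  omega

/-- On a cycle of odd length the equation `y i + y (i + 1) = 2 a i` is solvable in integers. -/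
lemma exists_add_succ_eq_two_mul (hD : Even D) (a : ZMod (D + 1) → ℤ) :
    ∃ y : ZMod (D + 1) → ℤ, ∀ i, y i + y (i + 1) = 2 * a i := by
  refine ⟨fun i => ∑ j ∈ Finset.range (D + 1), (-1) ^ j * a (i + (j : ZMod (D + 1))), fun i => ?_⟩
  have h1 : ∑ j ∈ Finset.range (D + 1), (-1 : ℤ) ^ j * a (i + 1 + (j : ZMod (D + 1))) =
      -∑ j ∈ Finset.range (D + 1), (-1 : ℤ) ^ (j + 1) * a (i + ((j + 1 : ℕ) : ZMod (D + 1))) := by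
    rw [← Finset.sum_neg_distrib]
    refine Finset.sum_congr rfl fun j _ => ?_
    rw [Nat.cast_succ, show i + 1 + (j : ZMod (D + 1)) = i + ((j : ZMod (D + 1)) + 1) by ring]
    ring
  have h2 := Finset.sum_range_succ' (fun j => (-1 : ℤ) ^ j * a (i + (j : ZMod (D + 1)))) (D + 1)
  rw [Finset.sum_range_succ, natCast_period, hD.add_one.neg_one_pow] at h2
  simp only [Nat.cast_zero, pow_zero, add_zero] at h2
  simp only [h1]
  linear_combination h2

lemma exists_lift (hD : Even D) (f : Wsp D) :
    ∃ z : ZMod (D + 1) → ℤ, (∀ i, z i + z (i + 1) = 0 ∨ z i + z (i + 1) = 1) ∧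
      ∃ c : ZMod 2, ∀ i, (z i : ZMod 2) = f i + c := by
  set x : ZMod (D + 1) → ℤ := fun i => ((f i).val : ℤ) with hx
  have hx01 : ∀ i, x i = 0 ∨ x i = 1 := by
    intro i
    have := ZMod.val_lt (f i)
    simp only [hx]
    omega
  obtain ⟨y, hy⟩ := exists_add_succ_eq_two_mul hD fun i => x i * x (i + 1)
  refine ⟨fun i => x i - y i, fun i => ?_, -(y 0 : ZMod 2), fun i => ?_⟩
  · have := hy i
    rcases hx01 i with h | h <;> rcases hx01 (i + 1) with h' | h' <;>
      simp only [h, h'] at this ⊢ <;> omega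
  · have hpar : ∀ t : ℕ, (y (0 + (t : ZMod (D + 1))) : ZMod 2) = y 0 := by
      intro t
      induction t with
      | zero => simp
      | succ t ih =>
        have := congrArg (Int.cast : ℤ → ZMod 2) (hy (0 + (t : ZMod (D + 1))))
        push_cast at this
        have two : (2 : ZMod 2) = 0 := rfl
        rw [Nat.cast_succ, ← add_assoc]
        linear_combination this - ih +
          ((x (0 + t) : ZMod 2) * x (0 + t + 1) - y 0) * two
    obtain ⟨t, -, ht⟩ := exists_coord 0 i
    have h1 := hpar t
    rw [← ht] at h1
    push_cast
    rw [h1, sub_eq_add_neg]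
    simp [hx]

lemma phi.foldInt_gB (hD : Even D) {B : Finset (Finset (ZMod (D + 1)))} (hB : phi D B)
    (i : ZMod (D + 1)) : foldInt (gB D B i) + foldInt (gB D B (i + 1)) = 0 ∨
      foldInt (gB D B i) + foldInt (gB D B (i + 1)) = 1 :=
  (foldInt_add_foldInt _ _).2 (hB.isDepth hD i (i + 1) (Or.inl rfl))

lemma epsB_injOn (hD : Even D) : Set.InjOn (epsB D) {B | phi D B} := by
  intro B hB B' hB' h
  change phi D B at hB
  change phi D B' at hB'
  rw [epsB_eq_mk, epsB_eq_mk, mk_eq_mk_iff] at h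
  obtain ⟨c, hc⟩ := h
  have hz := eq_of_mod_two hD (hB.foldInt_gB hD) (hB'.foldInt_gB hD) hc
  have hg : gB D B = gB D B' := funext fun i => foldInt_injective (congrFun hz i)
  rw [← hB.compFamily_gB hD, ← hB'.compFamily_gB hD, hg]

lemma epsB_surjOn (hD : Even D) : Set.SurjOn (epsB D) {B | phi D B} Set.univ := by
  intro v _
  obtain ⟨f, rfl⟩ := Submodule.Quotient.mk_surjective _ v
  obtain ⟨z, hz, hc⟩ := exists_lift hD f
  choose g hg using fun i => foldInt_surjective (z i)
  have hstep : ∀ i, g (i + 1) = g i + 1 ∨ g i = g (i + 1) + 1 ∨ (g i = 0 ∧ g (i + 1) = 0) :=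
    fun i => (foldInt_add_foldInt _ _).1 (by rw [hg, hg]; exact hz i)
  have hdepth : IsDepth D g := by
    rintro x y (rfl | rfl)
    · exact hstep x
    · have := hstep y
      tauto
  refine ⟨compFamily D g, phi_compFamily hD hdepth, ?_⟩
  rw [epsB_eq_mk, gB_compFamily hD hdepth, mk_eq_mk_iff]
  simpa only [hg] using hc

end Epsilon

/-- `ε : φ(V_D) → V_D` is a bijection, and `ε(B) ∈ ⟨B⟩` for every `B ∈ φ(V_D)`. -/
theorem eps_bijective (D : ℕ) (hD : 2 ≤ D) (hDev : Even D) :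
    Set.BijOn (epsB D) {B | phi D B} Set.univ ∧
    ∀ B, phi D B → epsB D B ∈ spanB D B :=
  ⟨⟨fun _ _ => Set.mem_univ _, epsB_injOn hDev, epsB_surjOn hDev⟩, fun _ hB => hB.epsB_mem_spanB⟩
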